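/- The indecomposable objects of the category C²(inj CQ) of two-term complexes of injective representations of a Dynkin quiver Q are exactly: the minimal injective resolutions φ[α] of the indecomposable representations M[α] (α a positive root), the complexes (0 → I_i) for each vertex i, and the identity complexes ν_i = (I_i → I_i); these form a complete list of indecomposables up to isomorphism. -/

import Mathlib

/-!
STATEMENT 11: The indecomposable objects of the category C²(inj ℂQ) of two-term
complexes (morphisms) of injective representations of a Dynkin quiver Q are
exactly: the minimal injective copresentations φ[α] of the indecomposable
representations (α a positive root), the complexes (0 → Iᵢ), and the identity
complexes νᵢ = (Iᵢ → Iᵢ); up to isomorphism these form a complete list.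

We express this as: a morphism φ : J⁰ ⟶ J¹ between injective objects is
indecomposable (in the morphism category, i.e. it is not the zero object and
any decomposition φ ≅ ρ ⊕ ν has a zero summand) iff either φ ≅ id_{Iᵢ}, or
φ ≅ (0 → Iᵢ), or φ is a minimal injective copresentation (both essentiality
conditions) of the indecomposable representation Ker φ.  By Gabriel's theorem,
the indecomposable representations are the M[α], α ∈ Δ⁺, so the third family
is exactly {φ[α] : α ∈ Δ⁺}.
-/

open CategoryTheory Limits

/-- Indecomposability of a two-term complex `φ : J⁰ ⟶ J¹`, i.e. of the
corresponding object of the morphism category: it is nonzero, and in any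
direct sum decomposition one summand is zero. -/
def TwoTermIndecomposable {C : Type*} [Category C] [Abelian C]
    [HasFiniteBiproducts C] {J0 J1 : C} (φ : J0 ⟶ J1) : Prop :=
  (¬ (IsZero J0 ∧ IsZero J1)) ∧
  ∀ (A0 A1 B0 B1 : C) (ρ : A0 ⟶ A1) (ν : B0 ⟶ B1),
    (Arrow.mk φ ≅ Arrow.mk (biprod.map ρ ν)) →
      ((IsZero A0 ∧ IsZero A1) ∨ (IsZero B0 ∧ IsZero B1))

namespace TwoTerm

variable {C : Type*} [Category C] [Abelian C]

/-- A monomorphism is essential if every morphism that is mono after precomposition with it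
is already mono. -/
def IsEssential {A B : C} (u : A ⟶ B) : Prop :=
  Mono u ∧ ∀ (X : C) (g : B ⟶ X), Mono (u ≫ g) → Mono g

/-- An idempotent endomorphism splits its object as a biproduct. -/
lemma exists_biprod_iso_of_idempotent {X : C} (e : X ⟶ X) (he : e ≫ e = e) :
    ∃ (Y Z : C) (α : X ≅ Y ⊞ Z),
      e = α.hom ≫ biprod.fst ≫ biprod.inl ≫ α.inv ∧
      𝟙 X - e = α.hom ≫ biprod.snd ≫ biprod.inr ≫ α.inv := by
  obtain ⟨Y, i, p, hip, hpi⟩ := IsIdempotentComplete.idempotents_split X e he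
  obtain ⟨Z, j, q, hjq, hqj⟩ := IsIdempotentComplete.idempotents_split X (𝟙 X - e)
    (by simp [he])
  have hiq : i ≫ q = 0 := by
    have : i ≫ q = i ≫ (p ≫ i) ≫ (q ≫ j) ≫ q := by
      simp [hjq, reassoc_of% hip]
    rw [this, hpi, hqj]
    simp [reassoc_of% he]
  have hjp : j ≫ p = 0 := by
    have : j ≫ p = j ≫ (q ≫ j) ≫ (p ≫ i) ≫ p := by
      simp [hip, reassoc_of% hjq]
    rw [this, hpi, hqj]
    simp [reassoc_of% he]
  refine ⟨Y, Z, ⟨biprod.lift p q, biprod.desc i j, ?_, ?_⟩, ?_, ?_⟩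
  · simp [biprod.lift_desc, hpi, hqj]
  · ext <;> simp [hip, hjq, hiq, hjp]
  · simp [hpi]
  · simp [hqj]

lemma Indecomposable.idempotent_eq {X : C} (hX : Indecomposable X) (e : X ⟶ X)
    (he : e ≫ e = e) : e = 0 ∨ e = 𝟙 X := by
  obtain ⟨Y, Z, α, h1, h2⟩ := exists_biprod_iso_of_idempotent e he
  rcases hX.2 Y Z α with h | h
  · left
    rw [h1, h.eq_of_src (biprod.inl ≫ α.inv) 0]
    simp
  · right
    have : 𝟙 X - e = 0 := by
      rw [h2, h.eq_of_src (biprod.inr ≫ α.inv) 0]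
      simp
    exact (sub_eq_zero.1 this).symm

/-- A two-term complex is indecomposable iff it is nonzero and its only idempotent
endomorphisms are the trivial ones. -/
lemma twoTermIndecomposable_iff [HasFiniteBiproducts C] {J0 J1 : C} (φ : J0 ⟶ J1) :
    TwoTermIndecomposable φ ↔ ¬ (IsZero J0 ∧ IsZero J1) ∧
      ∀ (e : J0 ⟶ J0) (f : J1 ⟶ J1), e ≫ e = e → f ≫ f = f → e ≫ φ = φ ≫ f →
        (e = 0 ∧ f = 0) ∨ (e = 𝟙 J0 ∧ f = 𝟙 J1) := by
  refine and_congr_right fun _ => ⟨fun h e f he hf hef => ?_, fun h A0 A1 B0 B1 ρ ν α => ?_⟩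
  · obtain ⟨A0, B0, α, he1, he2⟩ := exists_biprod_iso_of_idempotent e he
    obtain ⟨A1, B1, β, hf1, hf2⟩ := exists_biprod_iso_of_idempotent f hf
    have hcomm : α.hom ≫ biprod.map (biprod.inl ≫ α.inv ≫ φ ≫ β.hom ≫ biprod.fst)
        (biprod.inr ≫ α.inv ≫ φ ≫ β.hom ≫ biprod.snd) = φ ≫ β.hom := by
      rw [← cancel_mono β.inv]
      have e1 : e ≫ φ ≫ f = e ≫ φ := by rw [← hef, reassoc_of% he]
      have e2 : (𝟙 J0 - e) ≫ φ ≫ (𝟙 J1 - f) = φ - e ≫ φ := by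
        simp only [Preadditive.sub_comp, Preadditive.comp_sub, Category.id_comp,
          Category.comp_id, ← hef, reassoc_of% he, sub_self, sub_zero]
      have e3 : e ≫ φ ≫ f + (𝟙 J0 - e) ≫ φ ≫ (𝟙 J1 - f) = φ := by
        rw [e1, e2]; abel
      rw [he2, hf2, he1, hf1] at e3
      simp only [Category.assoc, Iso.hom_inv_id, Category.comp_id]
      refine Eq.trans ?_ e3
      simp [biprod.map_eq, Preadditive.add_comp, Preadditive.comp_add]
    rcases h _ _ _ _ _ _ (Arrow.isoMk α β hcomm) with ⟨h0, h1⟩ | ⟨h0, h1⟩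
    · left
      constructor
      · rw [he1, h0.eq_of_src (biprod.inl ≫ α.inv) 0]; simp
      · rw [hf1, h1.eq_of_src (biprod.inl ≫ β.inv) 0]; simp
    · right
      constructor
      · refine (sub_eq_zero.1 ?_).symm
        rw [he2, h0.eq_of_src (biprod.inr ≫ α.inv) 0]; simp
      · refine (sub_eq_zero.1 ?_).symm
        rw [hf2, h1.eq_of_src (biprod.inr ≫ β.inv) 0]; simp
  · let a : J0 ≅ A0 ⊞ B0 := Arrow.leftFunc.mapIso α
    let b : J1 ≅ A1 ⊞ B1 := Arrow.rightFunc.mapIso α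
    have w : a.hom ≫ biprod.map ρ ν = φ ≫ b.hom := Arrow.w_mk_right α.hom
    have w' : a.inv ≫ φ = biprod.map ρ ν ≫ b.inv := Arrow.w_mk_right α.inv
    clear_value a b
    have key := h (a.hom ≫ biprod.fst ≫ biprod.inl ≫ a.inv)
      (b.hom ≫ biprod.fst ≫ biprod.inl ≫ b.inv) (by simp) (by simp) (by
        simp only [Category.assoc, w', biprod.inl_map_assoc, ← reassoc_of% w,
          biprod.map_fst_assoc])
    have zero_of_idem : ∀ {X Y Z : C} (c : X ≅ Y ⊞ Z),
        c.hom ≫ biprod.fst ≫ biprod.inl ≫ c.inv = 0 → IsZero Y := by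
      intro X Y Z c hc
      rw [IsZero.iff_id_eq_zero]
      calc 𝟙 Y = biprod.inl ≫ c.inv ≫ (c.hom ≫ biprod.fst ≫ biprod.inl ≫ c.inv) ≫
            c.hom ≫ biprod.fst := by simp
        _ = 0 := by simp only [hc, zero_comp, comp_zero]
    have zero_of_idem' : ∀ {X Y Z : C} (c : X ≅ Y ⊞ Z),
        c.hom ≫ biprod.fst ≫ biprod.inl ≫ c.inv = 𝟙 X → IsZero Z := by
      intro X Y Z c hc
      rw [IsZero.iff_id_eq_zero]
      calc 𝟙 Z = biprod.inr ≫ c.inv ≫ 𝟙 X ≫ c.hom ≫ biprod.snd := by simp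
        _ = 0 := by rw [← hc]; simp
    exact key.imp (fun k => ⟨zero_of_idem a k.1, zero_of_idem b k.2⟩)
      (fun k => ⟨zero_of_idem' a k.1, zero_of_idem' b k.2⟩)

lemma mono_of_restrict_mono {X A B : C} (x : X ⟶ A) (f : A ⟶ B)
    [Mono x] (h : ∀ (P : C) (y : P ⟶ X), (y ≫ x) ≫ f = 0 → y ≫ x = 0) : Mono (x ≫ f) :=
  Preadditive.mono_of_cancel_zero _ fun y hy =>
    zero_of_comp_mono x (h _ y (by simpa using hy))

/-- An essential subobject meets every nonzero subobject nontrivially. -/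
lemma IsEssential.exists_meet {A E N : C} {u : A ⟶ E} (hu : IsEssential u)
    (y : N ⟶ E) [Mono y] (hy : y ≠ 0) :
    ∃ (Z : C) (z : Z ⟶ A) (w : Z ⟶ N), Mono z ∧ z ≠ 0 ∧ z ≫ u = w ≫ y := by
  have := hu.1
  refine ⟨pullback u y, pullback.fst u y, pullback.snd u y, inferInstance, fun h0 => hy ?_,
    pullback.condition⟩
  have : Mono (u ≫ cokernel.π y) := by
    refine Preadditive.mono_of_cancel_zero _ fun {P} x hx => ?_
    have hw : Abelian.monoLift y (x ≫ u) (by simpa using hx) ≫ y = x ≫ u :=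
      Abelian.monoLift_comp ..
    rw [← pullback.lift_fst (f := u) (g := y) x _ hw.symm, h0, comp_zero]
  have := hu.2 _ _ this
  exact zero_of_comp_mono (cokernel.π y) (cokernel.condition y)

/-- An essential simple subobject is contained in every nonzero subobject. -/
lemma IsEssential.exists_lift_of_simple {T E N : C} [Simple T] {u : T ⟶ E} (hu : IsEssential u)
    (y : N ⟶ E) [Mono y] (hy : y ≠ 0) : ∃ t : T ⟶ N, t ≫ y = u := by
  obtain ⟨Z, z, w, hz, hz0, hzw⟩ := hu.exists_meet y hy
  have := isIso_of_mono_of_nonzero hz0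
  exact ⟨inv z ≫ w, by rw [Category.assoc, ← hzw, IsIso.inv_hom_id_assoc]⟩

lemma eq_id_of_mono_of_idem {C : Type*} [Category C] {X : C} (e : X ⟶ X) [Mono e] (he : e ≫ e = e) : e = 𝟙 X := by
  rw [← cancel_mono e, he, Category.id_comp]

/-- An idempotent killing an essential subobject is zero. -/
lemma eq_zero_of_idem {A X : C} (u : A ⟶ X) [Mono u]
    (hu : ∀ (Y : C) (g : X ⟶ Y), Mono (u ≫ g) → Mono g) (e : X ⟶ X) (he : e ≫ e = e)
    (h : u ≫ e = 0) : e = 0 := by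
  have : Mono (𝟙 X - e) := hu _ _ (by simpa [h])
  have := eq_id_of_mono_of_idem (𝟙 X - e) (by simp [he])
  simpa using this

/-- An idempotent fixing an essential subobject is the identity. -/
lemma eq_id_of_idem {C : Type*} [Category C] {A X : C} (u : A ⟶ X) [Mono u]
    (hu : ∀ (Y : C) (g : X ⟶ Y), Mono (u ≫ g) → Mono g) (e : X ⟶ X) (he : e ≫ e = e)
    (h : u ≫ e = u) : e = 𝟙 X := by
  have : Mono e := hu _ _ (by simpa [h])
  exact eq_id_of_mono_of_idem e he

/-- An essential extension of a simple object has only trivial idempotents. -/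
lemma IsEssential.idempotent_eq {T X : C} [Simple T] {u : T ⟶ X} (hu : IsEssential u)
    (e : X ⟶ X) (he : e ≫ e = e) : e = 0 ∨ e = 𝟙 X := by
  have := hu.1
  by_cases h : u ≫ e = 0
  · exact .inl (eq_zero_of_idem u hu.2 e he h)
  · have := hu.2 _ _ (mono_of_nonzero_from_simple h)
    exact .inr (eq_id_of_mono_of_idem e he)

lemma comp_retraction_of_image {X Y : C} (φ : X ⟶ Y) (r : Y ⟶ Abelian.image φ)
    (hr : Abelian.image.ι φ ≫ r = 𝟙 _) : φ ≫ r ≫ Abelian.image.ι φ = φ :=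
  calc φ ≫ r ≫ Abelian.image.ι φ
      = (Abelian.factorThruImage φ ≫ Abelian.image.ι φ) ≫ r ≫ Abelian.image.ι φ := by
        rw [Abelian.image.fac]
    _ = φ := by rw [Category.assoc, reassoc_of% hr, Abelian.image.fac]

/-- If `φ ≫ f` vanishes then so does `f` on the image of `φ`. -/
lemma image_ι_comp_eq_zero {X Y Z : C} (φ : X ⟶ Y) (f : Y ⟶ Z) (h : φ ≫ f = 0) :
    Abelian.image.ι φ ≫ f = 0 := by
  rw [← cancel_epi (Abelian.factorThruImage φ), ← Category.assoc, Abelian.image.fac, h,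
    comp_zero]

lemma IsEssential.not_isZero {T X : C} [Simple T] {u : T ⟶ X} (hu : IsEssential u) :
    ¬ IsZero X := by
  intro h
  have := hu.1
  exact Simple.not_isZero T (IsZero.of_mono u h)

section Hulls

variable {ι : Type*} {S I : ι → C} [∀ i, Simple (S i)] {emb : ∀ i, S i ⟶ I i}

/-- A nonzero object which embeds jointly into finitely many essential extensions of simple
objects contains one of these simple objects. -/
lemma exists_simple_of_jointly_mono (hemb : ∀ i, IsEssential (emb i)) {κ : Type*}
    (g : κ → ι) (s : Finset κ) :
    ∀ (N : C) (f : ∀ k, N ⟶ I (g k)), ¬ IsZero N →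
      (∀ (X : C) (x : X ⟶ N), (∀ k ∈ s, x ≫ f k = 0) → x = 0) →
      ∃ (i : ι) (t : S i ⟶ N), Mono t := by
  classical
  induction s using Finset.induction with
  | empty =>
    intro N f hN h
    exact absurd ((IsZero.iff_id_eq_zero N).2 (h _ (𝟙 N) (by simp))) hN
  | insert j s _ ih =>
    intro N f hN h
    by_cases hm : Mono (f j)
    · obtain ⟨t, ht⟩ := (hemb (g j)).exists_lift_of_simple (f j)
        (fun h0 => hN (IsZero.of_mono_eq_zero _ h0))
      have := (hemb (g j)).1
      exact ⟨_, t, mono_of_mono_fac ht⟩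
    · obtain ⟨i, t, ht⟩ := ih (kernel (f j)) (fun k => kernel.ι _ ≫ f k)
        (fun h0 => hm (Preadditive.mono_of_isZero_kernel _ h0)) (fun X x hx => by
          refine zero_of_comp_mono (kernel.ι (f j)) (h _ _ fun k hk => ?_)
          rcases Finset.mem_insert.1 hk with rfl | hk
          · simp
          · simpa using hx k hk)
      exact ⟨i, t ≫ kernel.ι _, mono_comp _ _⟩

lemma exists_simple_of_mono_biproduct [HasFiniteBiproducts C] (hemb : ∀ i, IsEssential (emb i))
    {κ : Type} [Finite κ] (g : κ → ι) {N : C} (u : N ⟶ ⨁ fun k => I (g k)) [Mono u]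
    (hN : ¬ IsZero N) : ∃ (i : ι) (t : S i ⟶ N), Mono t := by
  cases nonempty_fintype κ
  refine exists_simple_of_jointly_mono hemb g Finset.univ N (fun k => u ≫ biproduct.π _ k) hN
    fun X x hx => zero_of_comp_mono u ?_
  ext k
  simpa using hx k (Finset.mem_univ k)

/-- A subobject of a finite sum of injective hulls of simple objects has an injective hull. -/
lemma exists_injective_hull [HasFiniteBiproducts C] (hemb : ∀ i, IsEssential (emb i))
    (hinj : ∀ i, Injective (I i)) {κ : Type} [Finite κ] (g : κ → ι) {A : C}
    (a : A ⟶ ⨁ fun k => I (g k)) [Mono a] :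
    ∃ (E : C) (u : A ⟶ E), Injective E ∧ IsEssential u := by
  classical
  cases nonempty_fintype κ
  let f : ∀ k, A ⟶ I (g k) := fun k => a ≫ biproduct.π _ k
  obtain ⟨s, hs, hmin⟩ := (wellFounded_lt (α := Finset κ)).has_min
    {s | ∀ (X : C) (x : X ⟶ A), (∀ k ∈ s, x ≫ f k = 0) → x = 0}
    ⟨Finset.univ, fun X x hx => by
      refine zero_of_comp_mono a ?_
      ext k
      simpa [f] using hx k (Finset.mem_univ k)⟩
  clear_value f
  have hv : ∀ j : s, ∃ v : S (g j) ⟶ A, v ≫ f j = emb (g j) ∧ ∀ k ∈ s, k ≠ j → v ≫ f k = 0 := by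
    rintro ⟨j, hj⟩
    have hlt : ∃ (X : C) (x : X ⟶ A), (∀ k ∈ s.erase j, x ≫ f k = 0) ∧ x ≠ 0 := by
      by_contra! hcon
      exact hmin _ hcon (Finset.erase_ssubset hj)
    obtain ⟨X, x, hx, hx0⟩ := hlt
    have hk : ∀ k ∈ s, k ≠ j → Abelian.image.ι x ≫ f k = 0 := fun k hk hkj => by
      rw [← cancel_epi (Abelian.factorThruImage x)]
      simpa using hx k (Finset.mem_erase.2 ⟨hkj, hk⟩)
    have hm : Mono (Abelian.image.ι x ≫ f j) := by
      refine mono_of_restrict_mono _ _ fun P y hy => hs _ _ fun k hks => ?_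
      by_cases hkj : k = j
      · subst hkj; exact hy
      · rw [Category.assoc, hk k hks hkj, comp_zero]
    have hne : Abelian.image.ι x ≫ f j ≠ 0 := fun h0 => hx0 <| by
      have : Abelian.image.ι x = 0 := hs _ _ fun k hks => by
        by_cases hkj : k = j
        · subst hkj; exact h0
        · exact hk k hks hkj
      rw [← Abelian.image.fac x, this, comp_zero]
    obtain ⟨t, ht⟩ := (hemb (g j)).exists_lift_of_simple _ hne
    exact ⟨t ≫ Abelian.image.ι x, by simpa using ht, fun k hks hkj => by
      rw [Category.assoc, hk k hks hkj, comp_zero]⟩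
  choose v hv1 hv2 using hv
  have hu : Mono (biproduct.lift fun k : s => f k) :=
    Preadditive.mono_of_cancel_zero _ fun {P} x hx => hs _ x fun k hk => by
      simpa using congrArg (· ≫ biproduct.π _ (⟨k, hk⟩ : s)) hx
  refine ⟨⨁ fun k : s => I (g k), biproduct.lift fun k : s => f k, inferInstance, hu,
    fun X q hq => ?_⟩
  by_contra hm
  obtain ⟨i, t', ht'⟩ := exists_simple_of_mono_biproduct hemb (fun k : s => g k) (kernel.ι q)
    (fun h0 => hm (Preadditive.mono_of_isZero_kernel _ h0))
  set t := t' ≫ kernel.ι q with ht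
  have htq : t ≫ q = 0 := by simp [ht]
  have htm : Mono t := mono_comp _ _
  clear_value t
  have hτ : ∀ k : s, ∃ τ : S i ⟶ S (g k), τ ≫ emb (g k) = t ≫ biproduct.π _ k := fun k => by
    by_cases h0 : t ≫ biproduct.π (fun k : s => I (g k)) k = 0
    · exact ⟨0, by rw [h0, zero_comp]⟩
    · have := mono_of_nonzero_from_simple h0
      obtain ⟨r, hr⟩ := (hemb (g k)).exists_lift_of_simple _ h0
      have := (hemb (g k)).1
      have : Mono r := mono_of_mono_fac hr
      have hr0 : r ≠ 0 := fun h => Simple.not_isZero (S (g k)) (IsZero.of_mono_eq_zero r h)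
      have := isIso_of_mono_of_nonzero hr0
      exact ⟨inv r, by rw [← hr, IsIso.inv_hom_id_assoc]⟩
  choose τ hτ using hτ
  have hfac : (∑ k, τ k ≫ v k) ≫ (biproduct.lift fun k : s => f k) = t := by
    ext k
    rw [Category.assoc, biproduct.lift_π, Preadditive.sum_comp, Finset.sum_eq_single k]
    · rw [Category.assoc, hv1, hτ]
    · intro l _ hl
      rw [Category.assoc, hv2 l k k.2 (fun h => hl (Subtype.ext h.symm)), comp_zero]
    · simp
  have hz : (∑ k, τ k ≫ v k) = 0 := by
    refine zero_of_comp_mono ((biproduct.lift fun k : s => f k) ≫ q) ?_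
    rw [← Category.assoc, hfac, htq]
  rw [hz, zero_comp] at hfac
  exact Simple.not_isZero (S i) (IsZero.of_mono_eq_zero t hfac.symm)

end Hulls

/-- Two independent subobjects of an injective object can be separated by an idempotent,
provided the first one has an injective hull. -/
lemma exists_idempotent_of_disjoint {A B J E : C} (a : A ⟶ J) (b : B ⟶ J) [Mono a] [Mono b]
    (hab : ∀ (X : C) (x : X ⟶ A) (y : X ⟶ B), x ≫ a = y ≫ b → x = 0)
    (hJ : Injective J) (hE : Injective E) {u : A ⟶ E} (hu : IsEssential u) :
    ∃ e : J ⟶ J, e ≫ e = e ∧ a ≫ e = a ∧ b ≫ e = 0 := by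
  have := hu.1
  let h : E ⟶ J := Injective.factorThru a u
  have huh : u ≫ h = a := Injective.comp_factorThru a u
  have hh : Mono h := hu.2 _ _ (by rw [huh]; infer_instance)
  let r : J ⟶ E := Injective.factorThru (𝟙 E) h
  have hr : h ≫ r = 𝟙 E := Injective.comp_factorThru _ _
  clear_value h r
  have hbp : Mono (b ≫ cokernel.π h) := by
    refine Preadditive.mono_of_isZero_kernel _ ?_
    set x := kernel.ι (b ≫ cokernel.π h) with hx
    have hxh : (x ≫ b) ≫ cokernel.π h = 0 := by simp [hx]
    let y := Abelian.monoLift h (x ≫ b) hxh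
    have hy : y ≫ h = x ≫ b := Abelian.monoLift_comp ..
    have : Mono y := mono_of_mono_fac hy
    clear_value y
    by_contra hne
    obtain ⟨Z, z, w, _, hz0, hzw⟩ := hu.exists_meet y
      (fun h0 => hne (IsZero.of_mono_eq_zero y h0))
    exact hz0 (hab Z z (w ≫ x) (by
      rw [← huh, reassoc_of% hzw, hy, Category.assoc]))
  let t : cokernel h ⟶ E := Injective.factorThru (b ≫ r) (b ≫ cokernel.π h)
  have ht : b ≫ cokernel.π h ≫ t = b ≫ r := by
    rw [← Category.assoc]
    exact Injective.comp_factorThru (b ≫ r) (b ≫ cokernel.π h)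
  have hr' : h ≫ (r - cokernel.π h ≫ t) = 𝟙 E := by simp [hr]
  have hb : b ≫ (r - cokernel.π h ≫ t) = 0 := by simp [ht]
  generalize r - cokernel.π h ≫ t = r' at hr' hb
  refine ⟨r' ≫ h, by simp [reassoc_of% hr'], ?_, by simp [reassoc_of% hb]⟩
  rw [← huh, Category.assoc, reassoc_of% hr']

end TwoTerm

theorem indecomposables_of_two_term_injective_complexes
    {C : Type*} [Category C] [Abelian C] [HasFiniteBiproducts C] [Linear ℂ C]
    {ι : Type} [Fintype ι] [DecidableEq ι]
    (S Ihull : ι → C) [∀ i, Simple (S i)]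
    (emb : ∀ i, S i ⟶ Ihull i) (hmono : ∀ i, Mono (emb i))
    (hinj : ∀ i, Injective (Ihull i))
    (hess : ∀ i (A : C) (g : Ihull i ⟶ A), Mono (emb i ≫ g) → Mono g)
    (hereditary : ∀ (I J : C) (f : I ⟶ J), Injective I → Epi f → Injective J)
    (hinjclass : ∀ J : C, Injective J →
      ∃ (n : ℕ) (g : Fin n → ι), Nonempty (J ≅ ⨁ fun j : Fin n => Ihull (g j)))
    {J0 J1 : C} (hJ0 : Injective J0) (hJ1 : Injective J1) (φ : J0 ⟶ J1) :
    TwoTermIndecomposable φ ↔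
      ((∃ i, Nonempty (Arrow.mk φ ≅ Arrow.mk (𝟙 (Ihull i)))) ∨
       (∃ i, IsZero J0 ∧ Nonempty (J1 ≅ Ihull i)) ∨
       (Indecomposable (kernel φ) ∧
        (∀ (A : C) (g : J0 ⟶ A), Mono (kernel.ι φ ≫ g) → Mono g) ∧
        (∀ (A : C) (g : J1 ⟶ A), Mono (Abelian.image.ι φ ≫ g) → Mono g))) := by
  classical
  have hemb : ∀ i, TwoTerm.IsEssential (emb i) := fun i => ⟨hmono i, hess i⟩
  rw [TwoTerm.twoTermIndecomposable_iff]
  constructor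
  · rintro ⟨hne, hid⟩
    have hIm : Injective (Abelian.image φ) :=
      hereditary _ _ (Abelian.factorThruImage φ) hJ0 inferInstance
    have hsplit := hid (𝟙 J0)
      (Injective.factorThru (𝟙 _) (Abelian.image.ι φ) ≫ Abelian.image.ι φ) (by simp)
      (by simp) (by
        rw [TwoTerm.comp_retraction_of_image φ _ (Injective.comp_factorThru _ _),
          Category.id_comp])
    rcases hsplit with ⟨h0, -⟩ | ⟨-, h1⟩
    · have hz0 : IsZero J0 := (IsZero.iff_id_eq_zero J0).2 h0
      refine .inr (.inl ?_)
      obtain ⟨n, g, ⟨α⟩⟩ := hinjclass J1 hJ1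
      have hz1 : ¬ IsZero J1 := fun h => hne ⟨hz0, h⟩
      have hj : ∃ j : Fin n, True := by
        by_contra! hcon
        refine hz1 ((IsZero.iff_id_eq_zero J1).2 ?_)
        rw [← cancel_mono α.hom]
        ext j
        exact (hcon j).elim
      obtain ⟨j, -⟩ := hj
      refine ⟨g j, hz0, ⟨α.hom ≫ biproduct.π (fun j => Ihull (g j)) j,
        biproduct.ι (fun j => Ihull (g j)) j ≫ α.inv, ?_, by simp⟩⟩
      rcases hid 0 (α.hom ≫ biproduct.π (fun j => Ihull (g j)) j ≫
        biproduct.ι (fun j => Ihull (g j)) j ≫ α.inv) (by simp) (by simp) (hz0.eq_of_src _ _) with ⟨-, h⟩ | ⟨-, h⟩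
      · refine absurd ((IsZero.iff_id_eq_zero _).2 ?_) (hemb (g j)).not_isZero
        calc 𝟙 (Ihull (g j)) = biproduct.ι (fun j => Ihull (g j)) j ≫ α.inv ≫
              (α.hom ≫ biproduct.π (fun j => Ihull (g j)) j ≫
                biproduct.ι (fun j => Ihull (g j)) j ≫ α.inv) ≫
                α.hom ≫ biproduct.π (fun j => Ihull (g j)) j := by simp
          _ = 0 := by simp only [h, zero_comp, comp_zero]
      · simpa using h
    · have himepi : Epi (Abelian.image.ι φ) := epi_of_epi_fac h1
      have hiso : IsIso (Abelian.image.ι φ) := isIso_of_mono_of_epi _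
      have hepi : Epi φ := by rw [← Abelian.image.fac φ]; infer_instance
      obtain ⟨n, g, ⟨α⟩⟩ := hinjclass J0 hJ0
      by_cases hK : ∀ (A : C) (g : J0 ⟶ A), Mono (kernel.ι φ ≫ g) → Mono g
      · refine .inr (.inr ⟨⟨fun hz => hne ?_, fun A B β => ?_⟩, hK, fun A q hq => ?_⟩)
        · have hz0 : IsZero J0 := by
            have : Mono (0 : J0 ⟶ J0) := hK _ _ (hz.mono _)
            exact IsZero.of_mono_zero J0 J0
          exact ⟨hz0, IsZero.of_epi φ hz0⟩
        · let a := (biprod.inl ≫ β.inv) ≫ kernel.ι φ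
          let b := (biprod.inr ≫ β.inv) ≫ kernel.ι φ
          have : Mono a := mono_comp _ _
          have : Mono b := mono_comp _ _
          obtain ⟨E, u, hE, hu⟩ := TwoTerm.exists_injective_hull hemb hinj g (a ≫ α.hom)
          obtain ⟨e, he, hae, hbe⟩ := TwoTerm.exists_idempotent_of_disjoint a b (by
            intro X x y hxy
            have h2 : x ≫ biprod.inl = y ≫ biprod.inr := by
              rw [← cancel_mono β.inv, ← cancel_mono (kernel.ι φ)]
              simpa [a, b] using hxy
            simpa using congrArg (· ≫ biprod.fst) h2) hJ0 hE hu
          have hke : kernel.ι φ ≫ e ≫ φ = 0 := by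
            rw [← cancel_epi β.inv]
            apply biprod.hom_ext'
            · have : a ≫ e ≫ φ = 0 := by rw [reassoc_of% hae]; simp [a]
              simpa [a] using this
            · have : b ≫ e ≫ φ = 0 := by rw [reassoc_of% hbe, zero_comp]
              simpa [b] using this
          have hf : φ ≫ Abelian.epiDesc φ (e ≫ φ) hke = e ≫ φ := Abelian.comp_epiDesc ..
          rcases hid e (Abelian.epiDesc φ (e ≫ φ) hke) he (by
            rw [← cancel_epi φ, reassoc_of% hf, hf, reassoc_of% he]) hf.symm with ⟨h, -⟩ | ⟨h, -⟩
          · left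
            exact IsZero.of_mono_eq_zero a (by rw [← hae, h, comp_zero])
          · right
            exact IsZero.of_mono_eq_zero b (by rw [← hbe, h, Category.comp_id])
        · exact (mono_comp_iff_of_isIso (Abelian.image.ι φ) q).1 hq
      · refine .inl ?_
        push Not at hK
        obtain ⟨A, q, hq, hqm⟩ := hK
        obtain ⟨i, t, ht⟩ := TwoTerm.exists_simple_of_mono_biproduct hemb g
          (kernel.ι q ≫ α.hom) (fun h0 => hqm (Preadditive.mono_of_isZero_kernel _ h0))
        have hsφ : Mono ((t ≫ kernel.ι q) ≫ φ) := by
          refine TwoTerm.mono_of_restrict_mono _ _ fun P y hy => ?_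
          have hfac := kernel.lift_ι φ _ hy
          have hz : kernel.lift φ _ hy = 0 :=
            zero_of_comp_mono (kernel.ι φ ≫ q) (by rw [reassoc_of% hfac]; simp)
          rw [← hfac, hz, zero_comp]
        let h : Ihull i ⟶ J0 := Injective.factorThru (t ≫ kernel.ι q) (emb i)
        have hh : emb i ≫ h = t ≫ kernel.ι q := Injective.comp_factorThru _ _
        have hhφ : Mono (h ≫ φ) := hess i _ _ (by rw [reassoc_of% hh]; simpa using hsφ)
        obtain ⟨r, hr⟩ : ∃ r : J1 ⟶ Ihull i, h ≫ φ ≫ r = 𝟙 _ :=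
          ⟨Injective.factorThru (𝟙 _) (h ≫ φ), by
            rw [← Category.assoc]
            exact Injective.comp_factorThru (𝟙 _) (h ≫ φ)⟩
        rcases hid (φ ≫ r ≫ h) (r ≫ h ≫ φ) (by simp [reassoc_of% hr])
          (by simp [reassoc_of% hr]) (by simp) with ⟨h0, -⟩ | ⟨h0, h1⟩
        · refine absurd ((IsZero.iff_id_eq_zero _).2 ?_) (hemb i).not_isZero
          calc 𝟙 (Ihull i) = h ≫ (φ ≫ r ≫ h) ≫ φ ≫ r := by simp [hr]
            _ = 0 := by simp only [h0, zero_comp, comp_zero]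
        · exact ⟨i, ⟨Arrow.isoMk ⟨φ ≫ r, h, by simpa using h0, by simpa using hr⟩
            ⟨r, h ≫ φ, by simpa using h1, by simpa using hr⟩ (by simp)⟩⟩
  · rintro (⟨i, ⟨α⟩⟩ | ⟨i, hz0, ⟨β⟩⟩ | ⟨hK, hK0, hK1⟩)
    · let a : J0 ≅ Ihull i := Arrow.leftFunc.mapIso α
      let b : J1 ≅ Ihull i := Arrow.rightFunc.mapIso α
      have w : a.hom ≫ 𝟙 _ = φ ≫ b.hom := Arrow.w_mk_right α.hom
      clear_value a b
      have hφ : φ = a.hom ≫ b.inv := by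
        rw [← cancel_mono b.hom, ← w]; simp
      have hφe : Epi φ := by rw [hφ]; infer_instance
      refine ⟨fun h => (hemb i).not_isZero (h.1.of_iso a.symm), fun e f he hf hef => ?_⟩
      refine ((hemb i).idempotent_eq (a.inv ≫ e ≫ a.hom) (by simp [reassoc_of% he])).imp
        (fun h => ?_) (fun h => ?_)
      · have he0 : e = 0 := by
          simpa using congrArg (fun k => a.hom ≫ k ≫ a.inv) h
        refine ⟨he0, ?_⟩
        rw [← cancel_epi φ, ← hef, he0, zero_comp, comp_zero]
      · have he1 : e = 𝟙 J0 := by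
          simpa using congrArg (fun k => a.hom ≫ k ≫ a.inv) h
        refine ⟨he1, ?_⟩
        rw [← cancel_epi φ, ← hef, he1, Category.id_comp, Category.comp_id]
    · refine ⟨fun h => (hemb i).not_isZero (h.2.of_iso β.symm), fun e f he hf hef => ?_⟩
      refine ((hemb i).idempotent_eq (β.inv ≫ f ≫ β.hom) (by simp [reassoc_of% hf])).imp
        (fun h => ⟨hz0.eq_of_src _ _, ?_⟩) (fun h => ⟨hz0.eq_of_src _ _, ?_⟩)
      · simpa using congrArg (fun k => β.hom ≫ k ≫ β.inv) h
      · simpa using congrArg (fun k => β.hom ≫ k ≫ β.inv) h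
    · refine ⟨fun h => hK.1 (IsZero.of_mono (kernel.ι φ) h.1), fun e f he hf hef => ?_⟩
      have hk : (kernel.ι φ ≫ e) ≫ φ = 0 := by simp [hef]
      have hkι := kernel.lift_ι φ _ hk
      refine (TwoTerm.Indecomposable.idempotent_eq hK (kernel.lift φ _ hk) (by
        rw [← cancel_mono (kernel.ι φ), Category.assoc, hkι, reassoc_of% hkι, he])).imp
        (fun h => ?_) (fun h => ?_)
      · have he0 : e = 0 := TwoTerm.eq_zero_of_idem _ hK0 e he (by rw [← hkι, h, zero_comp])
        refine ⟨he0, TwoTerm.eq_zero_of_idem _ hK1 f hf ?_⟩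
        exact TwoTerm.image_ι_comp_eq_zero φ f (by rw [← hef, he0, zero_comp])
      · have he1 : e = 𝟙 _ := TwoTerm.eq_id_of_idem _ hK0 e he
          (by rw [← hkι, h, Category.id_comp])
        refine ⟨he1, TwoTerm.eq_id_of_idem _ hK1 f hf ?_⟩
        have := TwoTerm.image_ι_comp_eq_zero φ (f - 𝟙 _) (by simp [← hef, he1])
        simpa [sub_eq_zero] using this
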